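/- Suppose N ≥ 2. The orthonormal Ricci component R_t̂t̂(t) = −3 ä(t)/a(t) converges to a finite real limit as t → t⊙ from the right if and only if one of the following holds: (i) η₀ = 0 and η₁ ≥ 2; (ii) η₀ = 0, η₁ = 1 and η₂ ≥ 2; (iii) η₀ = 1 and η₁ ≥ 3. In all other cases −3 ä(t)/a(t) diverges to +∞ or −∞ as t → t⊙ from the right. -/

import Mathlib

open Filter Topology

lemma tendsto_sub_nhdsGT_zero (t0 : ℝ) : Tendsto (fun t => t - t0) (𝓝[>] t0) (𝓝[>] 0) := by
  refine tendsto_nhdsWithin_iff.2 ⟨?_, ?_⟩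
  · have h : Tendsto (fun t : ℝ => t - t0) (𝓝 t0) (𝓝 (t0 - t0)) :=
      tendsto_id.sub tendsto_const_nhds
    rw [sub_self] at h
    exact h.mono_left nhdsWithin_le_nhds
  · filter_upwards [self_mem_nhdsWithin] with t ht
    exact sub_pos.2 (Set.mem_Ioi.1 ht)

lemma tendsto_rpow_nhdsGT_zero {p : ℝ} (hp : 0 < p) :
    Tendsto (fun s : ℝ => s ^ p) (𝓝[>] 0) (𝓝 0) := by
  have h := (Real.continuousAt_rpow_const 0 p (Or.inr hp.le)).tendsto
  rw [Real.zero_rpow hp.ne'] at h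
  exact h.mono_left nhdsWithin_le_nhds

/-- A finite sum of real powers is asymptotic to its first nonvanishing term. -/
lemma tendsto_sum_rpow_div_rpow {n k : ℕ} {d e : ℕ → ℝ} (hk : k < n)
    (hd : ∀ i < k, d i = 0) (he : ∀ i < n, k < i → e k < e i) :
    Tendsto (fun s : ℝ => (∑ i ∈ Finset.range n, d i * s ^ e i) / s ^ e k) (𝓝[>] 0)
      (𝓝 (d k)) := by
  have h : Tendsto (fun s : ℝ => ∑ i ∈ Finset.range n, d i * s ^ (e i - e k)) (𝓝[>] 0)
      (𝓝 (∑ i ∈ Finset.range n, if i = k then d k else 0)) := by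
    refine tendsto_finsetSum _ fun i hi => ?_
    rcases lt_trichotomy i k with hik | rfl | hik
    · simp [hd i hik, hik.ne]
    · simp
    · have := (tendsto_rpow_nhdsGT_zero
        (sub_pos.2 (he i (Finset.mem_range.1 hi) hik))).const_mul (d i)
      simpa [hik.ne'] using this
  have hs : (∑ i ∈ Finset.range n, if i = k then d k else 0) = d k := by simp [hk]
  rw [hs] at h
  refine h.congr' ?_
  filter_upwards [self_mem_nhdsWithin] with s hs
  rw [Finset.sum_div]
  refine Finset.sum_congr rfl fun i _ => ?_
  rw [Real.rpow_sub hs, mul_div_assoc]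

lemma hasDerivAt_sum_rpow (n : ℕ) (c η : ℕ → ℝ) {t0 t : ℝ} (ht : t0 < t) :
    HasDerivAt (fun t => ∑ i ∈ Finset.range n, c i * (t - t0) ^ η i)
      (∑ i ∈ Finset.range n, c i * η i * (t - t0) ^ (η i - 1)) t := by
  refine HasDerivAt.fun_sum fun i _ => ?_
  have h := (((hasDerivAt_id t).sub_const t0).rpow_const (p := η i)
    (Or.inl (sub_pos.2 ht).ne')).const_mul (c i)
  simpa only [id, one_mul, mul_assoc] using h

lemma deriv_eq_sum_rpow {n : ℕ} {c η : ℕ → ℝ} {a : ℝ → ℝ} {t0 t1 : ℝ}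
    (ha : ∀ t ∈ Set.Ioo t0 t1, a t = ∑ i ∈ Finset.range n, c i * (t - t0) ^ η i) :
    ∀ t ∈ Set.Ioo t0 t1,
      deriv a t = ∑ i ∈ Finset.range n, c i * η i * (t - t0) ^ (η i - 1) := by
  intro t ht
  have h : a =ᶠ[𝓝 t] fun t => ∑ i ∈ Finset.range n, c i * (t - t0) ^ η i := by
    filter_upwards [isOpen_Ioo.mem_nhds ht] with s hs using ha s hs
  rw [h.deriv_eq, (hasDerivAt_sum_rpow n c η ht.1).deriv]

/-- If `η k` is the first exponent outside `{0, 1}`, then `ä/a` behaves like a nonzero multiple of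
`(t - t0) ^ (η k - 2 - η 0)`. -/
lemma tendsto_deriv_deriv_div_rpow {n k : ℕ} {η c : ℕ → ℝ} {a : ℝ → ℝ} {t0 t1 : ℝ}
    (ht : t0 < t1) (hk : k < n) (hη : ∀ i j : ℕ, i < j → j < n → η i < η j) (hc0 : c 0 ≠ 0)
    (hd : ∀ i < k, η i * (η i - 1) = 0)
    (ha : ∀ t ∈ Set.Ioo t0 t1, a t = ∑ i ∈ Finset.range n, c i * (t - t0) ^ η i) :
    Tendsto (fun t => -3 * deriv (deriv a) t / a t / (t - t0) ^ (η k - 2 - η 0)) (𝓝[>] t0)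
      (𝓝 (-3 * (c k * (η k * (η k - 1))) / c 0)) := by
  have hnum : Tendsto (fun s : ℝ => (∑ i ∈ Finset.range n,
      c i * (η i * (η i - 1)) * s ^ (η i - 2)) / s ^ (η k - 2)) (𝓝[>] 0)
      (𝓝 (c k * (η k * (η k - 1)))) :=
    tendsto_sum_rpow_div_rpow (d := fun i => c i * (η i * (η i - 1))) (e := fun i => η i - 2) hk
      (fun i hi => by simp only [hd i hi, mul_zero])
      (fun i hi hki => sub_lt_sub_right (hη k i hki hi) 2)
  have hden := tendsto_sum_rpow_div_rpow (d := c) (e := η) (k.zero_le.trans_lt hk)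
    (fun i hi => absurd hi i.not_lt_zero) (fun i hi h0 => hη 0 i h0 hi)
  refine ((((hnum.const_mul (-3)).div hden hc0).comp (tendsto_sub_nhdsGT_zero t0))).congr' ?_
  filter_upwards [Ioo_mem_nhdsGT ht] with t hs
  have hpos : 0 < t - t0 := sub_pos.2 hs.1
  have h2 : deriv (deriv a) t =
      ∑ i ∈ Finset.range n, c i * (η i * (η i - 1)) * (t - t0) ^ (η i - 2) := by
    rw [deriv_eq_sum_rpow (c := fun i => c i * η i) (η := fun i => η i - 1)
      (deriv_eq_sum_rpow ha) t hs]
    refine Finset.sum_congr rfl fun i _ => ?_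
    rw [show η i - 1 - 1 = η i - 2 by ring, mul_assoc (c i)]
  simp only [Function.comp, Pi.div_apply]
  rw [h2, ha t hs, Real.rpow_sub hpos (η k - 2)]
  have h3 := (Real.rpow_pos_of_pos hpos (η k - 2)).ne'
  have h4 := (Real.rpow_pos_of_pos hpos (η 0)).ne'
  field_simp

section PowerAsymptotics

variable {f : ℝ → ℝ} {t0 p Q : ℝ}

lemma eventuallyEq_div_rpow_mul :
    (fun t => f t / (t - t0) ^ p * (t - t0) ^ p) =ᶠ[𝓝[>] t0] f := by
  filter_upwards [self_mem_nhdsWithin] with t ht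
  exact div_mul_cancel₀ _ (Real.rpow_pos_of_pos (sub_pos.2 ht) p).ne'

lemma exists_tendsto_of_tendsto_div_rpow (hp : 0 ≤ p)
    (h : Tendsto (fun t => f t / (t - t0) ^ p) (𝓝[>] t0) (𝓝 Q)) :
    ∃ L : ℝ, Tendsto f (𝓝[>] t0) (𝓝 L) := by
  rcases hp.eq_or_lt with rfl | hp
  · exact ⟨Q, by simpa using h⟩
  · exact ⟨_, (h.mul ((tendsto_rpow_nhdsGT_zero hp).comp
      (tendsto_sub_nhdsGT_zero t0))).congr' eventuallyEq_div_rpow_mul⟩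

lemma tendsto_atTop_or_atBot_of_tendsto_div_rpow (hp : p < 0) (hQ : Q ≠ 0)
    (h : Tendsto (fun t => f t / (t - t0) ^ p) (𝓝[>] t0) (𝓝 Q)) :
    Tendsto f (𝓝[>] t0) atTop ∨ Tendsto f (𝓝[>] t0) atBot := by
  have hpow : Tendsto (fun t => (t - t0) ^ p) (𝓝[>] t0) atTop :=
    (tendsto_rpow_neg_nhdsGT_zero hp).comp (tendsto_sub_nhdsGT_zero t0)
  rcases hQ.lt_or_gt with hQ | hQ
  · exact Or.inr ((h.neg_mul_atTop hQ hpow).congr' eventuallyEq_div_rpow_mul)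
  · exact Or.inl ((h.pos_mul_atTop hQ hpow).congr' eventuallyEq_div_rpow_mul)

end PowerAsymptotics

/-- The `R_t̂t̂ = −3ä/a` theorem: for a generalized power-series scale factor, the
orthonormal Ricci component `−3ä/a` has a finite one-sided limit at the milestone
iff (i) `η₀ = 0, η₁ ≥ 2`, or (ii) `η₀ = 0, η₁ = 1, η₂ ≥ 2`, or (iii) `η₀ = 1, η₁ ≥ 3`;
in all other cases it diverges to `+∞` or `−∞`. -/
theorem Rtt_finite_limit_iff
    (t0 δ : ℝ) (N : ℕ) (η c : ℕ → ℝ) (a : ℝ → ℝ)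
    (hN : 2 ≤ N)
    (hδ : 0 < δ)
    (hηmono : ∀ i j : ℕ, i < j → j ≤ N → η i < η j)
    (hc0 : 0 < c 0)
    (hcne : ∀ i : ℕ, i ≤ N → c i ≠ 0)
    (ha : ∀ t ∈ Set.Ioo t0 (t0 + δ),
      a t = ∑ i ∈ Finset.range (N + 1), c i * (t - t0) ^ (η i)) :
    ((∃ L : ℝ, Tendsto (fun t => -3 * deriv (deriv a) t / a t) (𝓝[>] t0) (𝓝 L)) ↔
      ((η 0 = 0 ∧ 2 ≤ η 1) ∨ (η 0 = 0 ∧ η 1 = 1 ∧ 2 ≤ η 2) ∨ (η 0 = 1 ∧ 3 ≤ η 1))) ∧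
    (¬ ((η 0 = 0 ∧ 2 ≤ η 1) ∨ (η 0 = 0 ∧ η 1 = 1 ∧ 2 ≤ η 2) ∨ (η 0 = 1 ∧ 3 ≤ η 1)) →
      Tendsto (fun t => -3 * deriv (deriv a) t / a t) (𝓝[>] t0) atTop ∨
      Tendsto (fun t => -3 * deriv (deriv a) t / a t) (𝓝[>] t0) atBot) := by
  have key : ∀ k ≤ N, (∀ i < k, η i * (η i - 1) = 0) → η k * (η k - 1) ≠ 0 →
      (0 ≤ η k - 2 - η 0 →
        ∃ L : ℝ, Tendsto (fun t => -3 * deriv (deriv a) t / a t) (𝓝[>] t0) (𝓝 L)) ∧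
      (η k - 2 - η 0 < 0 →
        Tendsto (fun t => -3 * deriv (deriv a) t / a t) (𝓝[>] t0) atTop ∨
        Tendsto (fun t => -3 * deriv (deriv a) t / a t) (𝓝[>] t0) atBot) := by
    intro k hk hd hne
    have h := tendsto_deriv_deriv_div_rpow (lt_add_of_pos_right t0 hδ) (Nat.lt_succ_of_le hk)
      (fun i j hij hj => hηmono i j hij (Nat.le_of_lt_succ hj)) hc0.ne' hd ha
    exact ⟨fun hp => exists_tendsto_of_tendsto_div_rpow hp h, fun hp =>
      tendsto_atTop_or_atBot_of_tendsto_div_rpow hp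
        (div_ne_zero (mul_ne_zero (by norm_num) (mul_ne_zero (hcne k hk) hne)) hc0.ne') h⟩
  have h01 := hηmono 0 1 one_pos (by omega)
  have h12 := hηmono 1 2 (by omega) hN
  have hprod : ∀ x : ℝ, x ≠ 0 → x ≠ 1 → x * (x - 1) ≠ 0 := fun x h0 h1 =>
    mul_ne_zero h0 (sub_ne_zero.2 h1)
  have hfin : ((η 0 = 0 ∧ 2 ≤ η 1) ∨ (η 0 = 0 ∧ η 1 = 1 ∧ 2 ≤ η 2) ∨ (η 0 = 1 ∧ 3 ≤ η 1)) →
      ∃ L : ℝ, Tendsto (fun t => -3 * deriv (deriv a) t / a t) (𝓝[>] t0) (𝓝 L) := by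
    rintro (⟨h0, h1⟩ | ⟨h0, h1, h2⟩ | ⟨h0, h1⟩)
    · refine (key 1 (by omega) (fun i hi => ?_) (hprod _ ?_ ?_)).1 (by linarith)
      · simp [Nat.lt_one_iff.1 hi, h0]
      all_goals linarith
    · refine (key 2 hN (fun i hi => ?_) (hprod _ ?_ ?_)).1 (by linarith)
      · interval_cases i <;> simp [h0, h1]
      all_goals linarith
    · refine (key 1 (by omega) (fun i hi => ?_) (hprod _ ?_ ?_)).1 (by linarith)
      · simp [Nat.lt_one_iff.1 hi, h0]
      all_goals linarith
  have hinf : ¬ ((η 0 = 0 ∧ 2 ≤ η 1) ∨ (η 0 = 0 ∧ η 1 = 1 ∧ 2 ≤ η 2) ∨ (η 0 = 1 ∧ 3 ≤ η 1)) →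
      Tendsto (fun t => -3 * deriv (deriv a) t / a t) (𝓝[>] t0) atTop ∨
      Tendsto (fun t => -3 * deriv (deriv a) t / a t) (𝓝[>] t0) atBot := by
    intro hnot
    push Not at hnot
    obtain ⟨hi, hii, hiii⟩ := hnot
    by_cases h0 : η 0 = 0
    · by_cases h1 : η 1 = 1
      · refine (key 2 hN (fun i hi => ?_) (hprod _ ?_ ?_)).2 (by linarith [hii h0 h1])
        · interval_cases i <;> simp [h0, h1]
        all_goals linarith
      · refine (key 1 (by omega) (fun i hi => ?_) (hprod _ ?_ h1)).2 (by linarith [hi h0])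
        · simp [Nat.lt_one_iff.1 hi, h0]
        · linarith
    · by_cases h0' : η 0 = 1
      · refine (key 1 (by omega) (fun i hi => ?_) (hprod _ ?_ ?_)).2 (by linarith [hiii h0'])
        · simp [Nat.lt_one_iff.1 hi, h0']
        all_goals linarith
      · exact (key 0 (by omega) (fun i hi => absurd hi i.not_lt_zero) (hprod _ h0 h0')).2
          (by linarith)
  refine ⟨⟨fun ⟨L, hL⟩ => ?_, hfin⟩, hinf⟩
  by_contra hnot
  rcases hinf hnot with h | h
  · exact not_tendsto_nhds_of_tendsto_atTop h L hL
  · exact not_tendsto_nhds_of_tendsto_atBot h L hL
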